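/- Let h : ℝ → ℝ be continuous, let H : ℝ → ℝ be an antiderivative of h (H′ = h), let W be a real D × H matrix, and let b ∈ ℝᴴ and c ∈ ℝᴰ. Define s : ℝᴰ → ℝᴰ by s(x) = W h(Wᵀ x + b) + c, where h is applied componentwise. Then s is a gradient field: s(x) = ∇F(x) for all x, where F(x) = Σ_{k=1}^{H} H((Wᵀ x + b)_k) + ⟨c, x⟩. In particular, the output vector field of a one-layered autoencoder with tied weights (R = W) is conservative. -/

import Mathlib

open scoped RealInnerProductSpace

/-- A one-layered autoencoder with tied weights is conservative: if
`s(x) = W h(Wᵀ x + b) + c` with `h` continuous and `H` an antiderivative of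
`h`, then `s(x) = ∇F(x)` where `F(x) = ∑ₖ H((Wᵀ x + b)ₖ) + ⟨c, x⟩`. -/
theorem tied_autoencoder_is_gradient_field {D H : ℕ}
    (h : ℝ → ℝ) (h_cont : Continuous h)
    (A : ℝ → ℝ) (hA : ∀ t, HasDerivAt A (h t) t)
    (W : Matrix (Fin D) (Fin H) ℝ) (b : Fin H → ℝ)
    (c : EuclideanSpace ℝ (Fin D))
    (s : EuclideanSpace ℝ (Fin D) → EuclideanSpace ℝ (Fin D))
    (hs : ∀ x, ∀ i : Fin D,
      s x i = (∑ k, W i k * h ((∑ d, W d k * x d) + b k)) + c i) :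
    ∀ x, HasGradientAt
      (fun y : EuclideanSpace ℝ (Fin D) =>
        (∑ k, A ((∑ d, W d k * y d) + b k)) + ⟪c, y⟫) (s x) x := by
  intro x
  let w (k : Fin H) : EuclideanSpace ℝ (Fin D) := WithLp.toLp 2 fun d => W d k
  have inner_w (k : Fin H) (y : EuclideanSpace ℝ (Fin D)) :
      innerSL ℝ (w k) y = ∑ d, W d k * y d := by
    simp [w, PiLp.inner_apply, mul_comm]
  have hasFDerivAt_unit (k : Fin H) :
      HasFDerivAt (fun y : EuclideanSpace ℝ (Fin D) => A ((∑ d, W d k * y d) + b k))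
        (h ((∑ d, W d k * x d) + b k) • innerSL ℝ (w k)) x := by
    have hpre : HasFDerivAt (fun y => (∑ d, W d k * y d) + b k) (innerSL ℝ (w k)) x := by
      simpa only [inner_w] using (innerSL ℝ (w k)).hasFDerivAt.add_const (b k)
    exact (hA _).comp_hasFDerivAt x hpre
  have hs_eq : s x = ∑ k, h ((∑ d, W d k * x d) + b k) • w k + c := by
    ext i
    simp [hs, w, mul_comm]
  rw [hasGradientAt_iff_hasFDerivAt]
  refine ((HasFDerivAt.fun_sum fun k _ => hasFDerivAt_unit k).add
    (innerSL ℝ c).hasFDerivAt).congr_fderiv ?_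
  ext y
  simp [hs_eq]
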